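/- arXiv:2201.00703 — 5 statements merged into one kernel-verified Lean document; each statement's English description precedes it below -/
import Mathlib

section
/- Let γ ∈ (0,1] and let f : ℝ^n → ℝ be differentiable, monotone and γ-weakly DR-submodular. Then for any points x ≤ y (componentwise), ⟨y − x, ∇f(x)⟩ ≥ γ·(f(y) − f(x)). -/
open scoped RealInnerProductSpace
open Real

/-- For a monotone, differentiable, γ-weakly DR-submodular `f`, for any `x ≤ y` componentwise,
`⟪y - x, ∇f(x)⟫ ≥ γ (f y - f x)`. -/
theorem statement0 (n : ℕ) (γ : ℝ) (hγ : γ ∈ Set.Ioc (0 : ℝ) 1)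
    (f : EuclideanSpace ℝ (Fin n) → ℝ)
    (f' : EuclideanSpace ℝ (Fin n) → EuclideanSpace ℝ (Fin n))
    (hdiff : ∀ u, HasGradientAt f (f' u) u)
    (hmono : ∀ u, ∀ i, 0 ≤ f' u i)
    (hDR : ∀ u v : EuclideanSpace ℝ (Fin n), (∀ i, u i ≤ v i) → ∀ i, γ * f' v i ≤ f' u i)
    (x y : EuclideanSpace ℝ (Fin n)) (hxy : ∀ i, x i ≤ y i) :
    γ * (f y - f x) ≤ ⟪y - x, f' x⟫ := by
  have hline (t : ℝ) : HasDerivAt (fun s : ℝ => f (x + s • (y - x)))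
      ⟪f' (x + t • (y - x)), y - x⟫ t := by
    have hpath : HasDerivAt (fun s : ℝ => x + s • (y - x)) (y - x) t := by
      simpa using ((hasDerivAt_id t).smul_const (y - x)).const_add x
    simpa [Function.comp_def] using (hdiff _).hasFDerivAt.comp_hasDerivAt t hpath
  obtain ⟨c, hc, hslope⟩ := exists_hasDerivAt_eq_slope _ _ zero_lt_one
    (fun t _ => (hline t).continuousAt.continuousWithinAt) (fun t _ => hline t)
  have hfc : f y - f x = ⟪f' (x + c • (y - x)), y - x⟫ := by
    simpa using hslope.symm
  rw [hfc]
  simp only [PiLp.inner_apply, RCLike.inner_apply, conj_trivial, Finset.mul_sum]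
  refine Finset.sum_le_sum fun i _ => ?_
  have hd : 0 ≤ (y - x) i := by simpa using hxy i
  have hle := hDR x (x + c • (y - x))
    (fun j => by simpa using mul_nonneg hc.1.le (sub_nonneg.2 (hxy j))) i
  nlinarith [mul_le_mul_of_nonneg_right hle hd]
end

section
/- Let γ ∈ (0,1] and let f : ℝ^n → ℝ be differentiable, monotone and γ-weakly DR-submodular. Then for any points x ≤ y (componentwise), ⟨y − x, ∇f(y)⟩ ≤ (1/γ)·(f(y) − f(x)). -/
open scoped RealInnerProductSpace
open Real

/-- For a monotone, differentiable, γ-weakly DR-submodular `f`, for any `x ≤ y` componentwise,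
`⟪y - x, ∇f(y)⟫ ≤ (1/γ) (f y - f x)`. -/
theorem statement1 (n : ℕ) (γ : ℝ) (hγ : γ ∈ Set.Ioc (0 : ℝ) 1)
    (f : EuclideanSpace ℝ (Fin n) → ℝ)
    (f' : EuclideanSpace ℝ (Fin n) → EuclideanSpace ℝ (Fin n))
    (hdiff : ∀ u, HasGradientAt f (f' u) u)
    (hmono : ∀ u, ∀ i, 0 ≤ f' u i)
    (hDR : ∀ u v : EuclideanSpace ℝ (Fin n), (∀ i, u i ≤ v i) → ∀ i, γ * f' v i ≤ f' u i)
    (x y : EuclideanSpace ℝ (Fin n)) (hxy : ∀ i, x i ≤ y i) :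
    ⟪y - x, f' y⟫ ≤ (1 / γ) * (f y - f x) := by
  obtain ⟨z, ⟨a, b, ha, hb, hab, rfl⟩, hz⟩ := domain_mvt
    (fun u _ => (hdiff u).hasFDerivAt.hasFDerivWithinAt) convex_univ
    (Set.mem_univ x) (Set.mem_univ y)
  rw [InnerProductSpace.toDual_apply_apply] at hz
  have hle : ∀ i, (a • x + b • y) i ≤ y i := fun i => by
    simp only [PiLp.add_apply, PiLp.smul_apply, smul_eq_mul]
    calc a * x i + b * y i ≤ a * y i + b * y i := by gcongr; exact hxy i
      _ = y i := by rw [← add_mul, hab, one_mul]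
  rw [one_div, ← div_eq_inv_mul, le_div_iff₀ hγ.1, hz, real_inner_comm,
    PiLp.inner_apply, PiLp.inner_apply, Finset.sum_mul]
  refine Finset.sum_le_sum fun i _ => ?_
  have h := mul_le_mul_of_nonneg_left (hDR _ y hle i) (sub_nonneg.2 (hxy i))
  simp only [RCLike.inner_apply, conj_trivial, PiLp.sub_apply]
  linarith
end

section
/- Let γ > 0, let L > 0, and let f : ℝ^n → ℝ be differentiable and L-smooth (‖∇f(u) − ∇f(v)‖ ≤ L·‖u − v‖ for all u, v). Define ∇F(x) = ∫₀¹ e^{γ(z−1)}·∇f(z·x) dz. Then for all x, y ∈ ℝ^n, ‖∇F(x) − ∇F(y)‖ ≤ ((γ + e^{−γ} − 1)/γ²)·L·‖x − y‖. -/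
open scoped RealInnerProductSpace
open Real MeasureTheory

/-- The first moment of the exponential weight `e^{γ(z−1)}` on `[0, 1]`. -/
theorem integral_exp_mul_sub_one_mul_id {γ : ℝ} (hγ : γ ≠ 0) :
    ∫ z in (0 : ℝ)..1, exp (γ * (z - 1)) * z = (γ + exp (-γ) - 1) / γ ^ 2 := by
  have hderiv : ∀ z ∈ Set.uIcc (0 : ℝ) 1,
      HasDerivAt (fun z => exp (γ * (z - 1)) * (z / γ - 1 / γ ^ 2))
        (exp (γ * (z - 1)) * z) z := by
    intro z _
    have hexp : HasDerivAt (fun z => exp (γ * (z - 1))) (exp (γ * (z - 1)) * (γ * 1)) z :=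
      (((hasDerivAt_id z).sub_const 1).const_mul γ).exp
    have hlin : HasDerivAt (fun z : ℝ => z / γ - 1 / γ ^ 2) (1 / γ) z :=
      ((hasDerivAt_id z).div_const γ).sub_const _
    refine (hexp.mul hlin).congr_deriv ?_
    field_simp
    ring
  rw [intervalIntegral.integral_eq_sub_of_hasDerivAt hderiv
    (Continuous.intervalIntegrable (by fun_prop) _ _)]
  simp only [sub_self, mul_zero, exp_zero, zero_sub, mul_neg, mul_one, zero_div]
  field_simp
  ring

/-- Averaging an `L`-Lipschitz map over dilations with the weight `e^{γ(z−1)}` gives a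
Lipschitz map. -/
theorem norm_integral_exp_smul_comp_smul_sub_le {E G : Type*}
    [NormedAddCommGroup E] [NormedSpace ℝ E] [NormedAddCommGroup G] [NormedSpace ℝ G]
    {γ L : ℝ} (hγ : γ ≠ 0) (hL : 0 ≤ L) {g : E → G}
    (hg : ∀ u v, ‖g u - g v‖ ≤ L * ‖u - v‖) (x y : E) :
    ‖(∫ z in (0 : ℝ)..1, exp (γ * (z - 1)) • g (z • x))
        - ∫ z in (0 : ℝ)..1, exp (γ * (z - 1)) • g (z • y)‖
      ≤ (γ + exp (-γ) - 1) / γ ^ 2 * L * ‖x - y‖ := by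
  have hcont : Continuous g :=
    (LipschitzWith.of_dist_le_mul (K := L.toNNReal) fun u v => by
      simpa only [dist_eq_norm, coe_toNNReal L hL] using hg u v).continuous
  have hint : ∀ w : E, IntervalIntegrable
      (fun z : ℝ => exp (γ * (z - 1)) • g (z • w)) volume 0 1 := fun w =>
    Continuous.intervalIntegrable (by fun_prop) _ _
  rw [← intervalIntegral.integral_sub (hint x) (hint y)]
  calc _ ≤ ∫ z in (0 : ℝ)..1, exp (γ * (z - 1)) * z * (L * ‖x - y‖) := by
        refine intervalIntegral.norm_integral_le_of_norm_le zero_le_one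
          (Filter.Eventually.of_forall fun z hz => ?_)
          (Continuous.intervalIntegrable (by fun_prop) _ _)
        rw [← smul_sub, norm_smul, norm_of_nonneg (exp_pos _).le, mul_assoc]
        refine mul_le_mul_of_nonneg_left ((hg _ _).trans_eq ?_) (exp_pos _).le
        rw [← smul_sub, norm_smul, norm_of_nonneg hz.1.le]
        ring
    _ = _ := by
        rw [intervalIntegral.integral_mul_const, integral_exp_mul_sub_one_mul_id hγ, mul_assoc]

/-- For differentiable `L`-smooth `f`, the gradient of the auxiliary function,
`∇F(x) = ∫₀¹ e^{γ(z−1)} • ∇f(z • x) dz`, is `((γ + e^{−γ} − 1)/γ²) L`-Lipschitz. -/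
theorem statement16 (n : ℕ) (γ : ℝ) (hγ : 0 < γ) (L : ℝ) (hL : 0 < L)
    (f : EuclideanSpace ℝ (Fin n) → ℝ)
    (f' : EuclideanSpace ℝ (Fin n) → EuclideanSpace ℝ (Fin n))
    (hdiff : ∀ u, HasGradientAt f (f' u) u)
    (hsmooth : ∀ u v : EuclideanSpace ℝ (Fin n), ‖f' u - f' v‖ ≤ L * ‖u - v‖)
    (x y : EuclideanSpace ℝ (Fin n)) :
    ‖(∫ z in (0 : ℝ)..1, exp (γ * (z - 1)) • f' (z • x))
        - ∫ z in (0 : ℝ)..1, exp (γ * (z - 1)) • f' (z • y)‖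
      ≤ (γ + exp (-γ) - 1) / γ ^ 2 * L * ‖x - y‖ :=
  norm_integral_exp_smul_comp_smul_sub_le hγ.ne' hL.le hsmooth x y
end

section
/- For any γ ∈ (0,1], ∫₀¹ ∫₀¹ e^{γ(u+z−2)}·(z − u)² du dz ≤ (1 − e^{−2γ})/(3γ). -/
open Real MeasureTheory

/-- The mean squared distance of two uniform points of the unit interval is `1 / 6`. -/
theorem integral_integral_sub_sq :
    ∫ z in (0 : ℝ)..1, ∫ u in (0 : ℝ)..1, (z - u) ^ 2 = 1 / 6 := by
  have inner (z : ℝ) : ∫ u in (0 : ℝ)..1, (z - u) ^ 2 = z ^ 2 - z + 1 / 3 := by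
    rw [intervalIntegral.integral_comp_sub_left (fun x => x ^ 2) z, integral_pow]
    norm_num
    ring
  simp_rw [inner]
  rw [intervalIntegral.integral_add (Continuous.intervalIntegrable (by fun_prop) _ _)
      (Continuous.intervalIntegrable (by fun_prop) _ _),
    intervalIntegral.integral_sub (Continuous.intervalIntegrable (by fun_prop) _ _)
      (Continuous.intervalIntegrable (by fun_prop) _ _), integral_pow, integral_id,
    intervalIntegral.integral_const]
  norm_num

/-- For any `γ ∈ (0,1]`, `∫₀¹ ∫₀¹ e^{γ(u+z−2)} (z − u)² du dz ≤ (1 − e^{−2γ})/(3γ)`. -/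
theorem statement18 (γ : ℝ) (hγ : γ ∈ Set.Ioc (0 : ℝ) 1) :
    ∫ z in (0 : ℝ)..1, ∫ u in (0 : ℝ)..1, exp (γ * (u + z - 2)) * (z - u) ^ 2
      ≤ (1 - exp (-2 * γ)) / (3 * γ) := by
  obtain ⟨hpos, hle⟩ := hγ
  have hweight : ∫ z in (0 : ℝ)..1, ∫ u in (0 : ℝ)..1, exp (γ * (u + z - 2)) * (z - u) ^ 2
      ≤ ∫ z in (0 : ℝ)..1, ∫ u in (0 : ℝ)..1, (z - u) ^ 2 := by
    refine intervalIntegral.integral_mono_on zero_le_one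
      (Continuous.intervalIntegrable
        (intervalIntegral.continuous_parametric_intervalIntegral_of_continuous'
          (by fun_prop) _ _) _ _)
      (Continuous.intervalIntegrable
        (intervalIntegral.continuous_parametric_intervalIntegral_of_continuous'
          (by fun_prop) _ _) _ _) fun z hz => ?_
    refine intervalIntegral.integral_mono_on zero_le_one
      (Continuous.intervalIntegrable (by fun_prop) _ _)
      (Continuous.intervalIntegrable (by fun_prop) _ _) fun u hu => ?_
    refine mul_le_of_le_one_left (sq_nonneg _) (exp_le_one_iff.mpr ?_)
    exact mul_nonpos_of_nonneg_of_nonpos hpos.le (by linarith [hz.2, hu.2])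
  have hexp : exp (-2 * γ) ≤ 1 / (1 + 2 * γ) := by
    rw [neg_mul, exp_neg, one_div]
    exact inv_anti₀ (by positivity) (by linarith [add_one_le_exp (2 * γ)])
  have hfrac : 1 / (1 + 2 * γ) ≤ 1 - γ / 2 := by
    rw [div_le_iff₀ (by positivity)]
    nlinarith
  calc _ ≤ (1 / 6 : ℝ) := hweight.trans_eq integral_integral_sub_sq
    _ ≤ _ := by
      rw [le_div_iff₀ (by positivity)]
      linarith
end

section
/- Let γ ∈ (0,1], let L > 0, and let f : ℝ^n → ℝ be differentiable and L-smooth. Define ∇F(x) = ∫₀¹ e^{γ(u−1)}·∇f(u·x) du. Then for any x ∈ ℝ^n, ∫₀¹ (γ·e^{γ(z−1)}/(1 − e^{−γ}))·‖((1 − e^{−γ})/γ)·∇f(z·x) − ∇F(x)‖² dz ≤ L²·‖x‖²·(1 − e^{−2γ})/(3γ). -/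
open scoped RealInnerProductSpace
open Real MeasureTheory

/-- The weighted variance of a curve is at most its weighted second moment about any point `b`. -/
theorem integral_weighted_variance_le {E : Type*} [NormedAddCommGroup E] [InnerProductSpace ℝ E]
    [CompleteSpace E] {w : ℝ → ℝ} {g : ℝ → E} (hw : Continuous w) (hg : Continuous g)
    {α β c : ℝ} (hc : ∫ z in α..β, w z = c) (hc0 : c ≠ 0) (b : E) :
    ∫ z in α..β, (w z / c) * ‖c • g z - ∫ u in α..β, w u • g u‖ ^ 2
      ≤ c * ∫ z in α..β, w z * ‖g z - b‖ ^ 2 := by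
  set N : E := ∫ z in α..β, w z • (g z - b) with hN
  have hM : ∫ u in α..β, w u • g u = N + c • b := by
    have h₁ : IntervalIntegrable (fun z => w z • g z) volume α β :=
      (hw.smul hg).intervalIntegrable _ _
    have h₂ : IntervalIntegrable (fun z => w z • b) volume α β :=
      (hw.smul continuous_const).intervalIntegrable _ _
    simp only [hN, smul_sub]
    rw [intervalIntegral.integral_sub h₁ h₂, intervalIntegral.integral_smul_const, hc]
    abel
  have hpt : ∀ z, (w z / c) * ‖c • g z - (N + c • b)‖ ^ 2
      = c * (w z * ‖g z - b‖ ^ 2) - 2 * ⟪N, w z • (g z - b)⟫ + w z * (‖N‖ ^ 2 / c) := by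
    intro z
    have h : c • g z - (N + c • b) = c • (g z - b) - N := by
      rw [smul_sub]; abel
    rw [h, norm_sub_sq_real, norm_smul, mul_pow, norm_eq_abs, sq_abs, real_inner_smul_left,
      real_inner_smul_right, real_inner_comm]
    field_simp
  have hi₁ : IntervalIntegrable (fun z => c * (w z * ‖g z - b‖ ^ 2)) volume α β :=
    Continuous.intervalIntegrable (by fun_prop) _ _
  have hi₂ : IntervalIntegrable (fun z => 2 * ⟪N, w z • (g z - b)⟫) volume α β :=
    Continuous.intervalIntegrable (by fun_prop) _ _
  have hi₃ : IntervalIntegrable (fun z => w z * (‖N‖ ^ 2 / c)) volume α β :=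
    Continuous.intervalIntegrable (by fun_prop) _ _
  have hi : IntervalIntegrable (fun z => w z • (g z - b)) volume α β :=
    Continuous.intervalIntegrable (by fun_prop) _ _
  have hinner : ∫ z in α..β, ⟪N, w z • (g z - b)⟫ = ‖N‖ ^ 2 := by
    rw [← real_inner_self_eq_norm_sq]
    exact (innerSL ℝ N).intervalIntegral_comp_comm hi
  rw [hM]
  simp only [hpt]
  rw [intervalIntegral.integral_add (hi₁.sub hi₂) hi₃, intervalIntegral.integral_sub hi₁ hi₂,
    intervalIntegral.integral_const_mul, intervalIntegral.integral_const_mul,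
    intervalIntegral.integral_mul_const, hinner, hc, mul_div_cancel₀ _ hc0]
  nlinarith [sq_nonneg ‖N‖]

theorem integral_exp_mul_sub_one {γ : ℝ} (hγ : γ ≠ 0) :
    ∫ z in (0 : ℝ)..1, exp (γ * (z - 1)) = (1 - exp (-γ)) / γ := by
  have hd : ∀ z ∈ Set.uIcc (0 : ℝ) 1,
      HasDerivAt (fun z => exp (γ * (z - 1)) / γ) (exp (γ * (z - 1))) z := by
    intro z _
    have h := ((((hasDerivAt_id z).sub_const 1).const_mul γ).exp).div_const γ
    simpa [hγ] using h
  rw [intervalIntegral.integral_eq_sub_of_hasDerivAt hd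
    (Continuous.intervalIntegrable (by fun_prop) _ _)]
  simp [sub_div]

/-- For differentiable `L`-smooth `f`, with `∇F(x) = ∫₀¹ e^{γ(u−1)} • ∇f(u • x) du`, the
variance of the estimator `((1 − e^{−γ})/γ) • ∇f(z • x)` under the density
`z ↦ γ e^{γ(z−1)}/(1 − e^{−γ})` on `[0,1]` is at most `L² ‖x‖² (1 − e^{−2γ})/(3γ)`. -/
theorem statement19 (n : ℕ) (γ : ℝ) (hγ : γ ∈ Set.Ioc (0 : ℝ) 1) (L : ℝ) (hL : 0 < L)
    (f : EuclideanSpace ℝ (Fin n) → ℝ)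
    (f' : EuclideanSpace ℝ (Fin n) → EuclideanSpace ℝ (Fin n))
    (hdiff : ∀ u, HasGradientAt f (f' u) u)
    (hsmooth : ∀ u v : EuclideanSpace ℝ (Fin n), ‖f' u - f' v‖ ≤ L * ‖u - v‖)
    (x : EuclideanSpace ℝ (Fin n)) :
    ∫ z in (0 : ℝ)..1,
        (γ * exp (γ * (z - 1)) / (1 - exp (-γ)))
          * ‖((1 - exp (-γ)) / γ) • f' (z • x)
              - ∫ u in (0 : ℝ)..1, exp (γ * (u - 1)) • f' (u • x)‖ ^ 2
      ≤ L ^ 2 * ‖x‖ ^ 2 * (1 - exp (-2 * γ)) / (3 * γ) := by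
  obtain ⟨hγ0, -⟩ := hγ
  set c := (1 - exp (-γ)) / γ with hc_def
  have hexp : exp (-γ) < 1 := exp_lt_one_iff.2 (by linarith)
  have hc : 0 < c := div_pos (by linarith) hγ0
  have hc1 : c ≤ 1 := by
    rw [hc_def, div_le_one hγ0]
    linarith [add_one_le_exp (-γ)]
  have hlip : LipschitzWith L.toNNReal f' := LipschitzWith.of_dist_le_mul fun u v => by
    simpa [dist_eq_norm, hL.le] using hsmooth u v
  have hcont : Continuous f' := hlip.continuous
  have hint := integral_exp_mul_sub_one hγ0.ne'
  have hg : Continuous fun z : ℝ => f' (z • x) := by fun_prop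
  have hvar := integral_weighted_variance_le (w := fun z => exp (γ * (z - 1))) (by fun_prop) hg
    hint hc.ne' (f' ((1 / 2 : ℝ) • x))
  have hmoment : ∫ z in (0 : ℝ)..1, exp (γ * (z - 1)) * ‖f' (z • x) - f' ((1 / 2 : ℝ) • x)‖ ^ 2
      ≤ c * (L ^ 2 * ‖x‖ ^ 2 / 4) := by
    rw [hc_def, ← hint, ← intervalIntegral.integral_mul_const]
    refine intervalIntegral.integral_mono_on zero_le_one
      (Continuous.intervalIntegrable (by fun_prop) _ _)
      (Continuous.intervalIntegrable (by fun_prop) _ _) fun z hz => ?_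
    gcongr
    have habs : |z - 1 / 2| ≤ 1 / 2 := abs_le.2 ⟨by linarith [hz.1], by linarith [hz.2]⟩
    have hle : ‖f' (z • x) - f' ((1 / 2 : ℝ) • x)‖ ≤ L * (1 / 2 * ‖x‖) := by
      refine (hsmooth _ _).trans ?_
      rw [← sub_smul, norm_smul, norm_eq_abs]
      gcongr
    calc ‖f' (z • x) - f' ((1 / 2 : ℝ) • x)‖ ^ 2 ≤ (L * (1 / 2 * ‖x‖)) ^ 2 := by gcongr
      _ = L ^ 2 * ‖x‖ ^ 2 / 4 := by ring
  have hweight : ∀ z, γ * exp (γ * (z - 1)) / (1 - exp (-γ)) = exp (γ * (z - 1)) / c := by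
    intro z
    have : 1 - exp (-γ) ≠ 0 := by linarith
    rw [hc_def]
    field_simp
  have hexp2 : exp (-2 * γ) = exp (-γ) ^ 2 := by
    rw [← exp_nat_mul]
    congr 1
    push_cast
    ring
  simp only [hweight]
  calc _ ≤ _ := hvar
    _ ≤ c * (c * (L ^ 2 * ‖x‖ ^ 2 / 4)) := by gcongr
    _ ≤ c * ((1 + exp (-γ)) * (L ^ 2 * ‖x‖ ^ 2 / 3)) := by
      gcongr
      · linarith [exp_pos (-γ)]
      · norm_num
    _ = L ^ 2 * ‖x‖ ^ 2 * (1 - exp (-2 * γ)) / (3 * γ) := by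
      rw [hexp2, hc_def]
      field_simp
      ring
end
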